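/- Let Δ be the tetrahedral group [3,5,3]⁺. Then Δ has exactly one normal subgroup K such that Δ/K is isomorphic to PSL(2, F₂₅); moreover, for every positive integer n with n ≠ 2, Δ has no normal subgroup K with Δ/K isomorphic to PSL(2, F_{5^n}). -/

import Mathlib

instance : Fact (Nat.Prime 5) := ⟨by norm_num⟩

/-- The relators of the tetrahedral group `Δ = [3,5,3]⁺`, on generators
`α = of 0`, `β = of 1`, `γ = of 2`. -/
def tetRelators : Set (FreeGroup (Fin 3)) :=
  { FreeGroup.of 0 ^ 3, FreeGroup.of 1 ^ 5, FreeGroup.of 2 ^ 3,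
    (FreeGroup.of 0 * FreeGroup.of 1) ^ 2, (FreeGroup.of 1 * FreeGroup.of 2) ^ 2,
    (FreeGroup.of 0 * FreeGroup.of 1 * FreeGroup.of 2) ^ 2 }

/-- The tetrahedral group `Δ = [3,5,3]⁺` as a presented group. -/
abbrev Tet : Type := PresentedGroup tetRelators

/-- `K` is a normal subgroup of `Δ` with `Δ/K ≅ PSL(2, F)`. -/
def IsPSLQuotient (F : Type) [Field F] (K : Subgroup Tet) : Prop :=
  ∃ f : Tet →* Matrix.ProjectiveSpecialLinearGroup (Fin 2) F,
    Function.Surjective f ∧ f.ker = K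


open Matrix

section General

variable {F : Type*} [Field F]

theorem SL2_mul_apply (M N : Matrix.SpecialLinearGroup (Fin 2) F) (i j : Fin 2) :
    (M * N) i j = M i 0 * N 0 j + M i 1 * N 1 j := by
  rw [Matrix.SpecialLinearGroup.coe_mul, mul_apply, Fin.sum_univ_two]

theorem mem_center_SL2_iff (M : Matrix.SpecialLinearGroup (Fin 2) F) :
    M ∈ Subgroup.center (Matrix.SpecialLinearGroup (Fin 2) F) ↔
      M 0 1 = 0 ∧ M 1 0 = 0 ∧ M 0 0 = M 1 1 := by
  rw [Matrix.SpecialLinearGroup.mem_center_iff]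
  constructor
  · rintro ⟨r, -, h⟩
    simp [← h]
  · rintro ⟨h01, h10, h⟩
    refine ⟨M 0 0, ?_, ?_⟩
    · have := M.det_coe
      rw [det_fin_two] at this
      simp only [Fintype.card_fin]
      linear_combination this + M 0 0 * h + M 0 1 * h10
    · ext i j
      fin_cases i <;> fin_cases j <;> simp [h01, h10, h]

theorem trace_eq_zero_of_sq_mem_center {M : Matrix.SpecialLinearGroup (Fin 2) F}
    (h : M ^ 2 ∈ Subgroup.center (Matrix.SpecialLinearGroup (Fin 2) F))
    (hM : M ∉ Subgroup.center (Matrix.SpecialLinearGroup (Fin 2) F)) : M 0 0 + M 1 1 = 0 := by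
  by_contra ht
  rw [mem_center_SL2_iff] at h hM
  simp only [pow_two, SL2_mul_apply] at h
  obtain ⟨h1, h2, h3⟩ := h
  refine hM ⟨?_, ?_, ?_⟩ <;> apply mul_left_cancel₀ ht
  · linear_combination h1
  · linear_combination h2
  · linear_combination h3

theorem trace_sq_eq_one_of_cube_mem_center {M : Matrix.SpecialLinearGroup (Fin 2) F}
    (h : M ^ 3 ∈ Subgroup.center (Matrix.SpecialLinearGroup (Fin 2) F))
    (hM : M ∉ Subgroup.center (Matrix.SpecialLinearGroup (Fin 2) F)) : (M 0 0 + M 1 1) ^ 2 = 1 := by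
  by_contra ht
  rw [← sub_eq_zero] at ht
  have hd := M.det_coe
  rw [det_fin_two] at hd
  rw [mem_center_SL2_iff] at h hM
  simp only [pow_succ, pow_zero, one_mul, SL2_mul_apply] at h
  obtain ⟨h1, h2, h3⟩ := h
  refine hM ⟨?_, ?_, ?_⟩ <;> apply mul_left_cancel₀ ht
  · linear_combination h1 + M 0 1 * hd
  · linear_combination h2 + M 1 0 * hd
  · linear_combination h3 + (M 0 0 - M 1 1) * hd

theorem trace_sq_eq_four_of_pow_five_mem_center (h5 : (5 : F) = 0)
    {M : Matrix.SpecialLinearGroup (Fin 2) F}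
    (h : M ^ 5 ∈ Subgroup.center (Matrix.SpecialLinearGroup (Fin 2) F))
    (hM : M ∉ Subgroup.center (Matrix.SpecialLinearGroup (Fin 2) F)) : (M 0 0 + M 1 1) ^ 2 = 4 := by
  by_contra ht
  rw [← sub_eq_zero] at ht
  replace ht : ((M 0 0 + M 1 1) ^ 2 - 4) ^ 2 ≠ 0 := pow_ne_zero 2 ht
  have hd := M.det_coe
  rw [det_fin_two] at hd
  rw [mem_center_SL2_iff] at h hM
  simp only [pow_succ, pow_zero, one_mul, SL2_mul_apply] at h
  obtain ⟨h1, h2, h3⟩ := h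
  refine hM ⟨?_, ?_, ?_⟩ <;> apply mul_left_cancel₀ ht
  · linear_combination h1 + M 0 1 * (3 * (M 0 0 + M 1 1) ^ 2 -
      (M 0 0 * M 1 1 - M 0 1 * M 1 0 + 1)) * hd + M 0 1 * (3 - (M 0 0 + M 1 1) ^ 2) * h5
  · linear_combination h2 + M 1 0 * (3 * (M 0 0 + M 1 1) ^ 2 -
      (M 0 0 * M 1 1 - M 0 1 * M 1 0 + 1)) * hd + M 1 0 * (3 - (M 0 0 + M 1 1) ^ 2) * h5
  · linear_combination h3 + (M 0 0 - M 1 1) * (3 * (M 0 0 + M 1 1) ^ 2 -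
      (M 0 0 * M 1 1 - M 0 1 * M 1 0 + 1)) * hd +
      (M 0 0 - M 1 1) * (3 - (M 0 0 + M 1 1) ^ 2) * h5

/-- Conjugation by an invertible matrix, as an automorphism of `SL₂`. -/
def conjSL2 (P Q : Matrix (Fin 2) (Fin 2) F) (h : P * Q = 1) :
    Matrix.SpecialLinearGroup (Fin 2) F ≃* Matrix.SpecialLinearGroup (Fin 2) F where
  toFun M := ⟨P * M * Q, by
    rw [det_mul, det_mul, M.det_coe, mul_one, ← det_mul, h, det_one]⟩
  invFun M := ⟨Q * M * P, by
    rw [det_mul, det_mul, M.det_coe, mul_one, ← det_mul, mul_eq_one_comm.mp h, det_one]⟩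
  left_inv M := by
    have h' := mul_eq_one_comm.mp h
    refine Subtype.ext ?_
    calc Q * (P * (M : Matrix (Fin 2) (Fin 2) F) * Q) * P = (Q * P) * M * (Q * P) := by
          simp only [Matrix.mul_assoc]
      _ = M := by simp [h']
  right_inv M := by
    refine Subtype.ext ?_
    calc P * (Q * (M : Matrix (Fin 2) (Fin 2) F) * P) * Q = (P * Q) * M * (P * Q) := by
          simp only [Matrix.mul_assoc]
      _ = M := by simp [h]
  map_mul' M N := by
    have h' := mul_eq_one_comm.mp h
    refine Subtype.ext ?_
    calc P * ((M : Matrix (Fin 2) (Fin 2) F) * N) * Q = P * M * 1 * N * Q := by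
          simp only [Matrix.mul_assoc, Matrix.one_mul]
      _ = (P * M * Q) * (P * N * Q) := by rw [← h']; simp only [Matrix.mul_assoc]

theorem trace_conjSL2 (P Q : Matrix (Fin 2) (Fin 2) F) (h : P * Q = 1)
    (M : Matrix.SpecialLinearGroup (Fin 2) F) :
    conjSL2 P Q h M 0 0 + conjSL2 P Q h M 1 1 = M 0 0 + M 1 1 := by
  have : trace (P * (M : Matrix (Fin 2) (Fin 2) F) * Q) = trace (M : Matrix (Fin 2) (Fin 2) F) := by
    rw [trace_mul_comm, ← Matrix.mul_assoc, mul_eq_one_comm.mp h, Matrix.one_mul]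
  rwa [trace_fin_two, trace_fin_two] at this

theorem map_mem_center_iff {G : Type*} [Group G] (e : G ≃* G) (g : G) :
    e g ∈ Subgroup.center G ↔ g ∈ Subgroup.center G := by
  simp only [Subgroup.mem_center_iff]
  rw [e.surjective.forall]
  simp only [← map_mul, e.injective.eq_iff]

/-- The upper unitriangular matrix with off-diagonal entry `t`. -/
def upperSL2 (t : F) : Matrix.SpecialLinearGroup (Fin 2) F := ⟨!![1, t; 0, 1], by simp⟩

/-- The normal form of the image of `α`. -/
def matA (F : Type*) [Field F] : Matrix.SpecialLinearGroup (Fin 2) F := ⟨!![0, 1; -1, 1], by simp⟩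

/-- The normal form of the image of `γ`, for `x` a root of `X² - X + 2`. -/
def matC (x : F) (hx : x ^ 2 = x - 2) : Matrix.SpecialLinearGroup (Fin 2) F :=
  ⟨!![x, -1; -1, 1 - x], by rw [det_fin_two_of]; linear_combination -hx⟩

theorem coe_upperSL2 (t : F) :
    (upperSL2 t : Matrix (Fin 2) (Fin 2) F) = !![1, t; 0, 1] := rfl

theorem coe_matA : (matA F : Matrix (Fin 2) (Fin 2) F) = !![0, 1; -1, 1] := rfl

theorem coe_matC (x : F) (hx : x ^ 2 = x - 2) :
    (matC x hx : Matrix (Fin 2) (Fin 2) F) = !![x, -1; -1, 1 - x] := rfl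

/-- The normal form of a lift to `SL₂` of a representation of `Δ`. -/
def tetRep (x : F) (hx : x ^ 2 = x - 2) :
    FreeGroup (Fin 3) →* Matrix.SpecialLinearGroup (Fin 2) F :=
  FreeGroup.lift ![matA F, upperSL2 1, matC x hx]

theorem exists_conj_eq {A B : Matrix.SpecialLinearGroup (Fin 2) F}
    (hA : A 0 0 + A 1 1 = 1) (hB : B 0 0 + B 1 1 = 2) (hAB : (A * B) 0 0 + (A * B) 1 1 = 0)
    (hB1 : B ∉ Subgroup.center (Matrix.SpecialLinearGroup (Fin 2) F)) :
    ∃ (P Q : Matrix (Fin 2) (Fin 2) F) (h : P * Q = 1),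
      conjSL2 P Q h (matA F) = A ∧ conjSL2 P Q h (upperSL2 1) = B := by
  have hdA := A.det_coe
  have hdB := B.det_coe
  rw [det_fin_two] at hdA hdB
  simp only [SL2_mul_apply] at hAB
  obtain ⟨u, v, huv, h1, h2⟩ : ∃ u v : F, (u ≠ 0 ∨ v ≠ 0) ∧
      B 0 0 * u + B 0 1 * v = u ∧ B 1 0 * u + B 1 1 * v = v := by
    by_cases hb : B 0 1 = 0 ∧ B 0 0 = 1
    · refine ⟨1 - B 1 1, B 1 0, ?_, ?_, ?_⟩
      · by_contra! hc
        exact hB1 ((mem_center_SL2_iff B).2 ⟨hb.1, hc.2, by rw [hb.2]; linear_combination hc.1⟩)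
      · grind
      · ring
    · refine ⟨B 0 1, 1 - B 0 0, ?_, ?_, ?_⟩
      · grind
      · ring
      · grind
  have hD : -(u * (A 1 0 * u + A 1 1 * v)) + v * (A 0 0 * u + A 0 1 * v) ≠ 0 := by
    intro h0
    have e1 : B 0 0 * (A 0 0 * u + A 0 1 * v) + B 0 1 * (A 1 0 * u + A 1 1 * v) =
        A 0 0 * u + A 0 1 * v - u := by grind
    have e2 : B 1 0 * (A 0 0 * u + A 0 1 * v) + B 1 1 * (A 1 0 * u + A 1 1 * v) =
        A 1 0 * u + A 1 1 * v - v := by grind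
    have hu : u ^ 2 = 0 := by grind
    have hv : v ^ 2 = 0 := by grind
    simp_all
  have hPA : !![u, -(A 0 0 * u + A 0 1 * v); v, -(A 1 0 * u + A 1 1 * v)] * !![0, 1; -1, 1] =
      (A : Matrix (Fin 2) (Fin 2) F) *
        !![u, -(A 0 0 * u + A 0 1 * v); v, -(A 1 0 * u + A 1 1 * v)] := by
    ext i j
    fin_cases i <;> fin_cases j <;> simp [mul_apply, Fin.sum_univ_two] <;> grind
  have hPB : !![u, -(A 0 0 * u + A 0 1 * v); v, -(A 1 0 * u + A 1 1 * v)] * !![1, 1; 0, 1] =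
      (B : Matrix (Fin 2) (Fin 2) F) *
        !![u, -(A 0 0 * u + A 0 1 * v); v, -(A 1 0 * u + A 1 1 * v)] := by
    ext i j
    fin_cases i <;> fin_cases j <;> simp [mul_apply, Fin.sum_univ_two] <;> grind
  set P : Matrix (Fin 2) (Fin 2) F :=
    !![u, -(A 0 0 * u + A 0 1 * v); v, -(A 1 0 * u + A 1 1 * v)] with hP
  have hPQ : P * P⁻¹ = 1 := mul_nonsing_inv P (isUnit_iff_ne_zero.2 (by
    rw [hP, det_fin_two_of]; convert hD using 1; ring))
  refine ⟨P, P⁻¹, hPQ, ?_, ?_⟩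
  · refine Subtype.ext ?_
    change P * !![0, 1; -1, 1] * P⁻¹ = (A : Matrix (Fin 2) (Fin 2) F)
    rw [hPA, Matrix.mul_assoc, hPQ, Matrix.mul_one]
  · refine Subtype.ext ?_
    change P * !![1, 1; 0, 1] * P⁻¹ = (B : Matrix (Fin 2) (Fin 2) F)
    rw [hPB, Matrix.mul_assoc, hPQ, Matrix.mul_one]

theorem mk_neg_SL2 (M : Matrix.SpecialLinearGroup (Fin 2) F) :
    QuotientGroup.mk' (Subgroup.center (Matrix.SpecialLinearGroup (Fin 2) F)) (-M) =
      QuotientGroup.mk' _ M := by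
  have : (-1 : Matrix.SpecialLinearGroup (Fin 2) F) ∈ Subgroup.center _ := by
    simp [mem_center_SL2_iff]
  rw [← neg_one_mul, map_mul, QuotientGroup.mk'_apply, (QuotientGroup.eq_one_iff _).2 this,
    one_mul]

theorem exists_lift_trace_eq_one {g : ProjectiveSpecialLinearGroup (Fin 2) F}
    (h3 : g ^ 3 = 1) (hg : g ≠ 1) :
    ∃ M : Matrix.SpecialLinearGroup (Fin 2) F, QuotientGroup.mk' _ M = g ∧
      M 0 0 + M 1 1 = 1 := by
  obtain ⟨M, rfl⟩ := QuotientGroup.mk'_surjective _ g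
  rw [← map_pow, QuotientGroup.mk'_apply, QuotientGroup.eq_one_iff] at h3
  rw [QuotientGroup.mk'_apply, Ne, QuotientGroup.eq_one_iff] at hg
  rcases sq_eq_one_iff.1 (trace_sq_eq_one_of_cube_mem_center h3 hg) with h | h
  · exact ⟨M, rfl, h⟩
  · exact ⟨-M, mk_neg_SL2 M, by simp; linear_combination -h⟩

theorem exists_lift_trace_eq_two (h5 : (5 : F) = 0)
    {g : ProjectiveSpecialLinearGroup (Fin 2) F} (hg5 : g ^ 5 = 1) (hg : g ≠ 1) :
    ∃ M : Matrix.SpecialLinearGroup (Fin 2) F, QuotientGroup.mk' _ M = g ∧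
      M 0 0 + M 1 1 = 2 := by
  obtain ⟨M, rfl⟩ := QuotientGroup.mk'_surjective _ g
  rw [← map_pow, QuotientGroup.mk'_apply, QuotientGroup.eq_one_iff] at hg5
  rw [QuotientGroup.mk'_apply, Ne, QuotientGroup.eq_one_iff] at hg
  have := trace_sq_eq_four_of_pow_five_mem_center h5 hg5 hg
  rcases sq_eq_sq_iff_eq_or_eq_neg.1 (this.trans (by norm_num : (4 : F) = 2 ^ 2)) with h | h
  · exact ⟨M, rfl, h⟩
  · exact ⟨-M, mk_neg_SL2 M, by simp; linear_combination -h⟩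

theorem trace_eq_zero_of_mk_sq_eq_one {M : Matrix.SpecialLinearGroup (Fin 2) F}
    {g : ProjectiveSpecialLinearGroup (Fin 2) F} (hM : QuotientGroup.mk' _ M = g)
    (h2 : g ^ 2 = 1) (hg : g ≠ 1) : M 0 0 + M 1 1 = 0 := by
  subst hM
  rw [← map_pow, QuotientGroup.mk'_apply, QuotientGroup.eq_one_iff] at h2
  rw [QuotientGroup.mk'_apply, Ne, QuotientGroup.eq_one_iff] at hg
  exact trace_eq_zero_of_sq_mem_center h2 hg

theorem ne_one_of_tetrahedral_relations {G : Type*} [Group G] {a b c : G} (ha : a ^ 3 = 1)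
    (hb : b ^ 5 = 1) (hc : c ^ 3 = 1) (hab : (a * b) ^ 2 = 1) (hbc : (b * c) ^ 2 = 1)
    (habc : (a * b * c) ^ 2 = 1) (h : ¬(a = 1 ∧ b = 1 ∧ c = 1)) :
    a ≠ 1 ∧ b ≠ 1 ∧ c ≠ 1 ∧ a * b ≠ 1 ∧ b * c ≠ 1 ∧ a * b * c ≠ 1 := by
  have key {g : G} {m n : ℕ} (hmn : m.Coprime n) (hm : g ^ m = 1) (hn : g ^ n = 1) : g = 1 := by
    simpa [hmn.gcd_eq_one] using pow_gcd_eq_one.2 ⟨hm, hn⟩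
  have hb1 : b ≠ 1 := by
    rintro rfl
    rw [mul_one] at hab
    rw [one_mul] at hbc
    exact h ⟨key (by norm_num) ha hab, rfl, key (by norm_num) hc hbc⟩
  refine ⟨?_, hb1, ?_, ?_, ?_, ?_⟩
  · rintro rfl
    rw [one_mul] at hab
    exact hb1 (key (by norm_num) hb hab)
  · rintro rfl
    rw [mul_one] at hbc
    exact hb1 (key (by norm_num) hb hbc)
  · intro h1
    rw [eq_inv_of_mul_eq_one_left h1, inv_pow, inv_eq_one] at ha
    exact hb1 (key (by norm_num) hb ha)
  · intro h1
    rw [eq_inv_of_mul_eq_one_right h1, inv_pow, inv_eq_one] at hc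
    exact hb1 (key (by norm_num) hb hc)
  · intro h1
    rw [eq_inv_of_mul_eq_one_left h1, inv_pow, inv_eq_one] at hab
    have hc1 : c = 1 := key (by norm_num) hc hab
    rw [hc1, mul_one] at hbc
    exact hb1 (key (by norm_num) hb hbc)

theorem exists_normal_form (h5 : (5 : F) = 0) (f : Tet →* ProjectiveSpecialLinearGroup (Fin 2) F)
    (hf : f ≠ 1) :
    ∃ (x : F) (hx : x ^ 2 = x - 2)
      (e : Matrix.SpecialLinearGroup (Fin 2) F ≃* Matrix.SpecialLinearGroup (Fin 2) F),
      ∀ w, f (PresentedGroup.mk tetRelators w) = QuotientGroup.mk' _ (e (tetRep x hx w)) := by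
  set φ := f.comp (PresentedGroup.mk tetRelators) with hφ
  have hrel : ∀ r ∈ tetRelators, φ r = 1 := fun r hr ↦ by
    rw [hφ, MonoidHom.comp_apply, PresentedGroup.one_of_mem hr, map_one]
  simp only [tetRelators, Set.mem_insert_iff, Set.mem_singleton_iff, forall_eq_or_imp, forall_eq,
    map_pow, map_mul] at hrel
  obtain ⟨ha, hb, hc, hab, hbc, habc⟩ := hrel
  obtain ⟨ha1, hb1, hc1, hab1, hbc1, habc1⟩ :=
    ne_one_of_tetrahedral_relations ha hb hc hab hbc habc (by
      rintro ⟨h0, h1, h2⟩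
      refine hf (PresentedGroup.ext fun i ↦ ?_)
      fin_cases i
      · exact h0
      · exact h1
      · exact h2)
  obtain ⟨A, hA, htA⟩ := exists_lift_trace_eq_one ha ha1
  obtain ⟨B, hB, htB⟩ := exists_lift_trace_eq_two h5 hb hb1
  obtain ⟨C, hC, htC⟩ := exists_lift_trace_eq_one hc hc1
  have htAB := trace_eq_zero_of_mk_sq_eq_one (M := A * B) (by rw [map_mul, hA, hB]) hab hab1
  have htBC := trace_eq_zero_of_mk_sq_eq_one (M := B * C) (by rw [map_mul, hB, hC]) hbc hbc1
  have htABC := trace_eq_zero_of_mk_sq_eq_one (M := A * B * C)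
    (by rw [map_mul, map_mul, hA, hB, hC]) habc habc1
  obtain ⟨P, Q, hPQ, rfl, rfl⟩ := exists_conj_eq htA htB htAB (by
    rwa [← hB, QuotientGroup.mk'_apply, Ne, QuotientGroup.eq_one_iff] at hb1)
  obtain ⟨C, rfl⟩ := (conjSL2 P Q hPQ).surjective C
  rw [trace_conjSL2] at htC
  rw [← map_mul, trace_conjSL2] at htBC
  rw [← map_mul, ← map_mul, trace_conjSL2] at htABC
  have hdC := C.det_coe
  rw [det_fin_two] at hdC
  simp only [SL2_mul_apply] at htBC htABC
  simp [coe_matA, coe_upperSL2] at htBC htABC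
  have h10 : C 1 0 = -1 := by linear_combination htBC - htC
  have h01 : C 0 1 = -1 := by linear_combination h10 - htABC
  have h11 : C 1 1 = 1 - C 0 0 := by linear_combination htC
  have hx : C 0 0 ^ 2 = C 0 0 - 2 := by
    rw [h10, h01, h11] at hdC
    linear_combination -hdC
  refine ⟨C 0 0, hx, conjSL2 P Q hPQ, fun w ↦ ?_⟩
  have hCx : matC (C 0 0) hx = C := by
    refine Subtype.ext ?_
    ext i j
    fin_cases i <;> fin_cases j <;> simp [matC, h10, h01, h11]
  refine DFunLike.congr_fun (f := φ)
    (g := (QuotientGroup.mk' _).comp ((conjSL2 P Q hPQ).toMonoidHom.comp (tetRep (C 0 0) hx))) ?_ w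
  refine FreeGroup.ext_hom _ _ fun i ↦ ?_
  fin_cases i
  · simpa [tetRep] using hA.symm
  · simpa [tetRep] using hB.symm
  · simpa [tetRep, hCx] using hC.symm

theorem tetRep_mem_center (h5 : (5 : F) = 0) {x : F} (hx : x ^ 2 = x - 2) :
    ∀ r ∈ tetRelators, tetRep x hx r ∈
      Subgroup.center (Matrix.SpecialLinearGroup (Fin 2) F) := by
  simp only [tetRelators, Set.mem_insert_iff, Set.mem_singleton_iff, forall_eq_or_imp, forall_eq,
    map_pow, map_mul, tetRep, FreeGroup.lift_apply_of, mem_center_SL2_iff]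
  simp only [pow_succ, pow_zero, one_mul, SL2_mul_apply, Matrix.cons_val_zero,
    Matrix.cons_val_one, Matrix.cons_val]
  simp only [coe_matA, coe_upperSL2, coe_matC, of_apply, cons_val', cons_val_zero, cons_val_one,
    cons_val_fin_one]
  refine ⟨?_, ?_, ?_, ?_, ?_, ?_⟩ <;> grind

theorem pow_five_eq_one_sub (h5 : (5 : F) = 0) {x : F} (hx : x ^ 2 = x - 2) : x ^ 5 = 1 - x := by
  linear_combination (x ^ 3 + x ^ 2 - x - 3) * hx + h5

theorem tetRep_frobenius [CharP F 5] {x y : F} (hx : x ^ 2 = x - 2) (hy : y ^ 2 = y - 2)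
    (hxy : x ^ 5 = y) (w : FreeGroup (Fin 3)) :
    tetRep y hy w = Matrix.SpecialLinearGroup.map (frobenius F 5) (tetRep x hx w) := by
  refine DFunLike.congr_fun (f := tetRep y hy)
    (g := (Matrix.SpecialLinearGroup.map (frobenius F 5)).comp (tetRep x hx)) ?_ w
  have hxy' : frobenius F 5 x = y := hxy
  refine FreeGroup.ext_hom _ _ fun i ↦ Subtype.ext ?_
  ext k l
  fin_cases i <;> fin_cases k <;> fin_cases l <;>
    simp [tetRep, coe_matA, coe_upperSL2, coe_matC, hxy']

theorem map_frobenius_mem_center_iff [CharP F 5] (M : Matrix.SpecialLinearGroup (Fin 2) F) :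
    Matrix.SpecialLinearGroup.map (frobenius F 5) M ∈ Subgroup.center _ ↔
      M ∈ Subgroup.center _ := by
  have hinj := frobenius_inj F 5
  simp only [mem_center_SL2_iff, Matrix.SpecialLinearGroup.map_apply_coe,
    RingHom.mapMatrix_apply, map_apply, hinj.eq_iff, map_eq_zero_iff _ hinj]

theorem tetRep_mem_center_congr [CharP F 5] (h5 : (5 : F) = 0) {x y : F} (hx : x ^ 2 = x - 2)
    (hy : y ^ 2 = y - 2) (w : FreeGroup (Fin 3)) :
    tetRep x hx w ∈ Subgroup.center _ ↔ tetRep y hy w ∈ Subgroup.center _ := by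
  have h : (y - x) * (y - (1 - x)) = 0 := by linear_combination hy - hx
  rcases mul_eq_zero.1 h with h | h
  · obtain rfl := sub_eq_zero.1 h
    rfl
  · rw [tetRep_frobenius hx hy ((pow_five_eq_one_sub h5 hx).trans (sub_eq_zero.1 h).symm),
      map_frobenius_mem_center_iff]

theorem upperSL2_add (s t : F) : upperSL2 (s + t) = upperSL2 s * upperSL2 t := by
  refine Subtype.ext ?_
  ext i j
  fin_cases i <;> fin_cases j <;>
    simp [SL2_mul_apply, coe_upperSL2, add_comm, -Matrix.SpecialLinearGroup.coe_mul]

theorem eq_top_of_upperSL2_mem (H : Subgroup (Matrix.SpecialLinearGroup (Fin 2) F))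
    (hA : matA F ∈ H) (hU : ∀ t, upperSL2 t ∈ H) : H = ⊤ := by
  set S : Matrix.SpecialLinearGroup (Fin 2) F := matA F * upperSL2 1 with hS
  have hSH : S ∈ H := mul_mem hA (hU 1)
  have hSc : (S : Matrix (Fin 2) (Fin 2) F) = !![0, 1; -1, 0] := by
    ext i j
    fin_cases i <;> fin_cases j <;> simp [hS, coe_matA, coe_upperSL2]
  have key (M : Matrix.SpecialLinearGroup (Fin 2) F) (hM : M 1 0 ≠ 0) : M ∈ H := by
    have hd := M.det_coe
    rw [det_fin_two] at hd
    have : M = upperSL2 ((M 0 0 - 1) / M 1 0) * (S * upperSL2 (-M 1 0) * S * S * S) *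
        upperSL2 ((M 1 1 - 1) / M 1 0) := by
      refine Subtype.ext ?_
      ext i j
      simp only [SL2_mul_apply, coe_upperSL2, hSc]
      fin_cases i <;> fin_cases j <;> simp <;> field_simp <;> grind
    rw [this]
    exact mul_mem (mul_mem (hU _)
      (mul_mem (mul_mem (mul_mem (mul_mem hSH (hU _)) hSH) hSH) hSH)) (hU _)
  refine (Subgroup.eq_top_iff' H).2 fun M ↦ ?_
  by_cases hM : M 1 0 = 0
  · refine (H.mul_mem_cancel_left hSH).1 (key _ ?_)
    have hd := M.det_coe
    rw [det_fin_two, hM] at hd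
    simp only [SL2_mul_apply, hSc]
    simp
    rintro h
    simp [h] at hd
  · exact key M hM

theorem exists_eq_add_mul [CharP F 5] (hF : Nat.card F = 25) {x : F} (hx : x ^ 2 = x - 2) (t : F) :
    ∃ i j : ℕ, t = i + j * x := by
  have h5 : (5 : F) = 0 := by exact_mod_cast CharP.cast_eq_zero F 5
  let := ZMod.algebra F 5
  have : Finite F := Nat.finite_of_card_ne_zero (by rw [hF]; norm_num)
  let φ : ZMod 5 × ZMod 5 →+ F := AddMonoidHom.coprod (algebraMap (ZMod 5) F).toAddMonoidHom
    ((AddMonoidHom.mulRight x).comp (algebraMap (ZMod 5) F).toAddMonoidHom)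
  have hφ (i j) : φ (i, j) = algebraMap (ZMod 5) F i + algebraMap (ZMod 5) F j * x := rfl
  have hinj : Function.Injective φ := by
    rw [injective_iff_map_eq_zero]
    rintro ⟨i, j⟩ h
    rw [hφ] at h
    have h' := congrArg (frobenius F 5) h
    simp only [frobenius_def, add_pow_char, mul_pow, ← map_pow, ZMod.pow_card,
      pow_five_eq_one_sub h5 hx] at h'
    have hj : algebraMap (ZMod 5) F j = 0 := by grind
    have hi : algebraMap (ZMod 5) F i = 0 := by simpa [hj] using h
    rw [map_eq_zero_iff _ (algebraMap (ZMod 5) F).injective] at hi hj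
    rw [hi, hj, Prod.mk_zero_zero]
  obtain ⟨⟨i, j⟩, rfl⟩ := (hinj.bijective_of_nat_card_le (by simp [hF])).2 t
  refine ⟨i.val, j.val, ?_⟩
  rw [hφ, ← map_natCast (algebraMap (ZMod 5) F), ← map_natCast (algebraMap (ZMod 5) F),
    ZMod.natCast_zmod_val, ZMod.natCast_zmod_val]

theorem tetRep_surjective [CharP F 5] (hF : Nat.card F = 25) {x : F} (hx : x ^ 2 = x - 2) :
    Function.Surjective (tetRep x hx) := by
  have h5 : (5 : F) = 0 := by exact_mod_cast CharP.cast_eq_zero F 5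
  rw [← MonoidHom.range_eq_top]
  have hA : matA F ∈ (tetRep x hx).range := ⟨FreeGroup.of 0, by simp [tetRep]⟩
  have hB : upperSL2 1 ∈ (tetRep x hx).range := ⟨FreeGroup.of 1, by simp [tetRep]⟩
  have hC : matC x hx ∈ (tetRep x hx).range := ⟨FreeGroup.of 2, by simp [tetRep]⟩
  let T : AddSubmonoid F :=
    { carrier := {t | upperSL2 t ∈ (tetRep x hx).range}
      zero_mem' := by
        have : upperSL2 (0 : F) = 1 := Subtype.ext (by
          rw [coe_upperSL2, Matrix.SpecialLinearGroup.coe_one, one_fin_two])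
        change upperSL2 (0 : F) ∈ (tetRep x hx).range
        rw [this]
        exact one_mem _
      add_mem' := fun {a b} ha hb ↦ by
        change upperSL2 (a + b) ∈ (tetRep x hx).range
        rw [upperSL2_add]
        exact mul_mem ha hb }
  have h1 : (1 : F) ∈ T := hB
  have h3 : 3 + 3 * x ∈ T := by
    have hACCB : ((matA F * matC x hx * matC x hx * upperSL2 1 :
        Matrix.SpecialLinearGroup (Fin 2) F) : Matrix (Fin 2) (Fin 2) F) =
        !![-1, -x - 1; -x, -2 * x + 1] := by
      ext i j
      simp only [SL2_mul_apply, coe_matA, coe_matC, coe_upperSL2]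
      fin_cases i <;> fin_cases j <;> simp <;> grind
    have hACBB : ((matA F * matC x hx * upperSL2 1 * upperSL2 1 :
        Matrix.SpecialLinearGroup (Fin 2) F) : Matrix (Fin 2) (Fin 2) F) =
        !![-1, -x - 1; -x - 1, 2 * x] := by
      ext i j
      simp only [SL2_mul_apply, coe_matA, coe_matC, coe_upperSL2]
      fin_cases i <;> fin_cases j <;> simp <;> grind
    have hCCA : ((matC x hx * matC x hx * matA F :
        Matrix.SpecialLinearGroup (Fin 2) F) : Matrix (Fin 2) (Fin 2) F) =
        !![1, x + 3; x, -x - 1] := by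
      ext i j
      simp only [SL2_mul_apply, coe_matA, coe_matC]
      fin_cases i <;> fin_cases j <;> simp <;> grind
    have h : upperSL2 (3 + 3 * x) = (matA F * matC x hx * matC x hx * upperSL2 1) *
        (matA F * matC x hx * upperSL2 1 * upperSL2 1) * (matC x hx * matC x hx * matA F) := by
      refine Subtype.ext ?_
      rw [Matrix.SpecialLinearGroup.coe_mul, Matrix.SpecialLinearGroup.coe_mul, hACCB, hACBB, hCCA,
        coe_upperSL2]
      ext i j
      fin_cases i <;> fin_cases j <;> simp [mul_apply, Fin.sum_univ_two] <;> grind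
    change upperSL2 (3 + 3 * x) ∈ (tetRep x hx).range
    rw [h]
    exact mul_mem (mul_mem (mul_mem (mul_mem (mul_mem hA hC) hC) hB)
      (mul_mem (mul_mem (mul_mem hA hC) hB) hB)) (mul_mem (mul_mem hC hC) hA)
  refine eq_top_of_upperSL2_mem _ hA fun t ↦ ?_
  obtain ⟨i, j, rfl⟩ := exists_eq_add_mul hF hx t
  have hx1 : x ∈ T := by
    have : x = (2 : ℕ) • (3 + 3 * x) + (4 : ℕ) • 1 := by
      simp only [nsmul_eq_mul]; push_cast
      linear_combination (-2 - x) * h5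
    rw [this]
    exact add_mem (nsmul_mem h3 2) (nsmul_mem h1 4)
  have := add_mem (nsmul_mem h1 i) (nsmul_mem hx1 j)
  rwa [nsmul_eq_mul, nsmul_eq_mul, mul_one] at this

theorem ne_one_of_surjective {f : Tet →* ProjectiveSpecialLinearGroup (Fin 2) F}
    (hf : Function.Surjective f) : f ≠ 1 := by
  rintro rfl
  obtain ⟨g, hg⟩ := hf (QuotientGroup.mk' _ (upperSL2 1))
  rw [MonoidHom.one_apply, eq_comm, QuotientGroup.mk'_apply, QuotientGroup.eq_one_iff,
    mem_center_SL2_iff] at hg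
  simp [coe_upperSL2] at hg

theorem exists_mk_mem_ker_iff (h5 : (5 : F) = 0)
    {f : Tet →* ProjectiveSpecialLinearGroup (Fin 2) F} (hf : Function.Surjective f) :
    ∃ (x : F) (hx : x ^ 2 = x - 2), ∀ w, PresentedGroup.mk tetRelators w ∈ f.ker ↔
      tetRep x hx w ∈ Subgroup.center _ := by
  obtain ⟨x, hx, e, h⟩ := exists_normal_form h5 f (ne_one_of_surjective hf)
  refine ⟨x, hx, fun w ↦ ?_⟩
  rw [MonoidHom.mem_ker, h, QuotientGroup.mk'_apply, QuotientGroup.eq_one_iff, map_mem_center_iff]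

theorem ker_eq_ker [CharP F 5] {f g : Tet →* ProjectiveSpecialLinearGroup (Fin 2) F}
    (hf : Function.Surjective f) (hg : Function.Surjective g) : f.ker = g.ker := by
  have h5 : (5 : F) = 0 := by exact_mod_cast CharP.cast_eq_zero F 5
  obtain ⟨x, hx, hfx⟩ := exists_mk_mem_ker_iff h5 hf
  obtain ⟨y, hy, hgy⟩ := exists_mk_mem_ker_iff h5 hg
  ext k
  obtain ⟨w, rfl⟩ := PresentedGroup.mk_surjective tetRelators k
  rw [hfx, hgy, tetRep_mem_center_congr h5 hx hy]

theorem exists_sq_eq_sub_two [CharP F 5] (hF : Nat.card F = 25) : ∃ x : F, x ^ 2 = x - 2 := by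
  have h5 : (5 : F) = 0 := by exact_mod_cast CharP.cast_eq_zero F 5
  have : Finite F := Nat.finite_of_card_ne_zero (by rw [hF]; norm_num)
  let := Fintype.ofFinite F
  have h3 : (3 : F) ≠ 0 := fun h ↦ one_ne_zero (α := F) (by linear_combination 2 * h - h5)
  obtain ⟨s, hs⟩ : IsSquare (3 : F) := by
    rw [FiniteField.isSquare_iff (by rw [ringChar.eq F 5]; norm_num) h3, ← Nat.card_eq_fintype_card,
      hF]
    norm_num
    linear_combination 106288 * h5
  exact ⟨3 * (1 + s), by linear_combination -9 * hs + (7 + 3 * s) * h5⟩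

theorem exists_surjective [CharP F 5] (hF : Nat.card F = 25) :
    ∃ f : Tet →* ProjectiveSpecialLinearGroup (Fin 2) F, Function.Surjective f := by
  have h5 : (5 : F) = 0 := by exact_mod_cast CharP.cast_eq_zero F 5
  obtain ⟨x, hx⟩ := exists_sq_eq_sub_two hF
  set ρ := (QuotientGroup.mk' (Subgroup.center (Matrix.SpecialLinearGroup (Fin 2) F))).comp
    (tetRep x hx) with hρ
  have hlift : FreeGroup.lift (fun i ↦ ρ (FreeGroup.of i)) = ρ :=
    FreeGroup.ext_hom _ _ fun i ↦ by simp
  have hrel : ∀ r ∈ tetRelators, FreeGroup.lift (fun i ↦ ρ (FreeGroup.of i)) r = 1 :=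
    fun r hr ↦ by
      rw [hlift, hρ, MonoidHom.comp_apply, QuotientGroup.mk'_apply, QuotientGroup.eq_one_iff]
      exact tetRep_mem_center h5 hx r hr
  refine ⟨PresentedGroup.toGroup hrel, fun g ↦ ?_⟩
  obtain ⟨w, rfl⟩ := ((QuotientGroup.mk'_surjective _).comp (tetRep_surjective hF hx)) g
  exact ⟨PresentedGroup.mk tetRelators w, DFunLike.congr_fun hlift w⟩

theorem tetRep_apply_pow [CharP F 5] {x : F} (hx : x ^ 2 = x - 2) (w : FreeGroup (Fin 3))
    (i j : Fin 2) : tetRep x hx w i j ^ 25 = tetRep x hx w i j := by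
  have h5 : (5 : F) = 0 := by exact_mod_cast CharP.cast_eq_zero F 5
  have hy : (1 - x) ^ 2 = 1 - x - 2 := by linear_combination hx
  have hyx : (1 - x) ^ 5 = x := (pow_five_eq_one_sub h5 hy).trans (sub_sub_cancel 1 x)
  have h := tetRep_frobenius hy hx hyx w
  rw [tetRep_frobenius hx hy (pow_five_eq_one_sub h5 hx) w] at h
  conv_rhs => rw [h]
  simp [frobenius_def, ← pow_mul]

theorem pow_eq_self_of_surjective [CharP F 5]
    {f : Tet →* ProjectiveSpecialLinearGroup (Fin 2) F} (hf : Function.Surjective f) (t : F) :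
    t ^ 25 = t := by
  have h5 : (5 : F) = 0 := by exact_mod_cast CharP.cast_eq_zero F 5
  obtain ⟨x, hx, e, h⟩ := exists_normal_form h5 f (ne_one_of_surjective hf)
  obtain ⟨k, hk⟩ := hf (QuotientGroup.mk' _ (e (upperSL2 t)))
  obtain ⟨w, rfl⟩ := PresentedGroup.mk_surjective tetRelators k
  rw [h, QuotientGroup.mk'_apply, QuotientGroup.mk'_apply, QuotientGroup.eq, ← map_inv, ← map_mul,
    map_mem_center_iff] at hk
  set Z := (tetRep x hx w)⁻¹ * upperSL2 t with hZ
  obtain ⟨h01, h10, h00⟩ := (mem_center_SL2_iff Z).1 hk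
  have hd := Z.det_coe
  rw [det_fin_two, h01, ← h00, zero_mul, sub_zero, ← pow_two] at hd
  have ht : t = tetRep x hx w 0 1 * Z 0 0 := by
    have : upperSL2 t = tetRep x hx w * Z := by rw [hZ, mul_inv_cancel_left]
    calc t = upperSL2 t 0 1 := rfl
      _ = _ := by rw [this, SL2_mul_apply, h01, h00, mul_zero, zero_add]
  have hz : Z 0 0 ^ 25 = Z 0 0 := by
    rw [pow_succ, show 24 = 2 * 12 from rfl, pow_mul, hd, one_pow, one_mul]
  rw [ht, mul_pow, hz, tetRep_apply_pow]

theorem eq_two_of_surjective [CharP F 5] {n : ℕ} (hn : 0 < n) (hF : Nat.card F = 5 ^ n)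
    {f : Tet →* ProjectiveSpecialLinearGroup (Fin 2) F} (hf : Function.Surjective f) : n = 2 := by
  have h5 : (5 : F) = 0 := by exact_mod_cast CharP.cast_eq_zero F 5
  have : Finite F := Nat.finite_of_card_ne_zero (by rw [hF]; positivity)
  let := Fintype.ofFinite F
  obtain ⟨g, hg⟩ := IsCyclic.exists_ofOrder_eq_natCard (α := Fˣ)
  have hg24 : g ^ 24 = 1 := by
    refine mul_left_cancel (a := g) (Units.ext ?_)
    rw [← pow_succ', mul_one, Units.val_pow_eq_pow_val]
    exact pow_eq_self_of_surjective hf _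
  have hle := Nat.le_of_dvd (by norm_num) (orderOf_dvd_of_pow_eq_one hg24)
  rw [hg, Nat.card_units, hF] at hle
  have hn2 : n ≤ 2 := by
    by_contra! h
    have := Nat.pow_le_pow_right (n := 5) (by norm_num) h
    omega
  by_contra hne
  obtain rfl : n = 1 := by omega
  obtain ⟨x, hx, -⟩ := exists_normal_form h5 f (ne_one_of_surjective hf)
  have hx5 : x ^ 5 = x := by
    have := FiniteField.pow_card x
    rwa [← Nat.card_eq_fintype_card, hF, pow_one] at this
  rw [pow_five_eq_one_sub h5 hx] at hx5
  refine one_ne_zero (α := F) ?_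
  grind

end General

theorem stmt_1 :
    (∃! K : Subgroup Tet, IsPSLQuotient (GaloisField 5 2) K) ∧
    ∀ n : ℕ, 0 < n → n ≠ 2 →
      ∀ K : Subgroup Tet, ¬ IsPSLQuotient (GaloisField 5 n) K := by
  constructor
  · have hF : Nat.card (GaloisField 5 2) = 25 := GaloisField.card 5 2 two_ne_zero
    obtain ⟨f, hf⟩ := exists_surjective hF
    refine ⟨f.ker, ⟨f, hf, rfl⟩, ?_⟩
    rintro _ ⟨g, hg, rfl⟩
    exact ker_eq_ker hg hf
  · rintro n hn hn2 _ ⟨f, hf, rfl⟩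
    exact hn2 (eq_two_of_surjective hn (GaloisField.card 5 n hn.ne') hf)
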